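/- Let s₀ be a complex eigenvalue of the companion matrix 𝒞 whose algebraic multiplicity is at least 2. Then, over ℂ, 𝒞 is similar to the 4×4 matrix 𝒥 consisting of two Jordan blocks of size 2 with eigenvalues s₀ and −s₀; that is, there exists an invertible 4×4 complex matrix Z with Z⁻¹·𝒞·Z = 𝒥, where 𝒥 has rows (s₀,1,0,0), (0,s₀,0,0), (0,0,−s₀,1), (0,0,0,−s₀). -/

import Mathlib

open Polynomial Matrix

theorem aux_charpoly (a b g h : ℝ) :
    (!![0, 0, 1, 0; 0, 0, 0, 1; -a, 0, 0, g; 0, -b, -h, 0] :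
      Matrix (Fin 4) (Fin 4) ℝ).charpoly
      = X ^ 4 + C (a + b + g * h) * X ^ 2 + C (a * b) := by
  rw [Matrix.charpoly, Matrix.det_succ_row_zero]
  simp [Fin.sum_univ_succ, Matrix.det_fin_three, Matrix.charmatrix_apply, Matrix.submatrix_apply,
    Fin.succAbove, Matrix.diagonal_apply]
  ring

theorem aux_main (a b g h : ℝ) (ha : a ≠ 0) (hb : b ≠ 0) (hg : g ≠ 0) (s : ℂ)
    (hm : 2 ≤ Polynomial.rootMultiplicity s
      (((!![0, 0, 1, 0; 0, 0, 0, 1; -a, 0, 0, g; 0, -b, -h, 0] :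
      Matrix (Fin 4) (Fin 4) ℝ).charpoly).map (algebraMap ℝ ℂ))) :
    ∃ Z : Matrix (Fin 4) (Fin 4) ℂ, IsUnit Z ∧
      Z⁻¹ * ((!![0, 0, 1, 0; 0, 0, 0, 1; -a, 0, 0, g; 0, -b, -h, 0] :
      Matrix (Fin 4) (Fin 4) ℝ).map (algebraMap ℝ ℂ)) * Z =
      !![s, 1, 0, 0; 0, s, 0, 0; 0, 0, -s, 1; 0, 0, 0, -s] := by
  have ha' : (a : ℂ) ≠ 0 := by exact_mod_cast ha
  have hb' : (b : ℂ) ≠ 0 := by exact_mod_cast hb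
  have hg' : (g : ℂ) ≠ 0 := by exact_mod_cast hg
  have hne : (((!![0, 0, 1, 0; 0, 0, 0, 1; -a, 0, 0, g; 0, -b, -h, 0] :
      Matrix (Fin 4) (Fin 4) ℝ).charpoly).map (algebraMap ℝ ℂ)) ≠ 0 :=
    ((Matrix.charpoly_monic _).map _).ne_zero
  have h2 := (Polynomial.one_lt_rootMultiplicity_iff_isRoot hne).1 hm
  obtain ⟨h0, h1⟩ := h2
  rw [aux_charpoly] at h0 h1
  simp [Polynomial.IsRoot, Polynomial.derivative_map] at h0 h1
  have hs : s ≠ 0 := by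
    rintro rfl
    simp [ha, hb] at h0
  have h1' : (a : ℂ) + b + g * h = -2 * s ^ 2 := by
    apply mul_left_cancel₀ (mul_ne_zero two_ne_zero hs)
    linear_combination h1
  have hab : (a : ℂ) * b = s ^ 4 := by
    linear_combination h0 - s ^ 2 * h1'
  let Z : Matrix (Fin 4) (Fin 4) ℂ :=
    !![g * s, g, -(g * s), g;
       s ^ 2 + a, 2 * s, s ^ 2 + a, -(2 * s);
       g * s ^ 2, 2 * g * s, g * s ^ 2, -(2 * g * s);
       s ^ 3 + a * s, 3 * s ^ 2 + a, -(s ^ 3 + a * s), 3 * s ^ 2 + a]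
  have hdet : Z.det = (-16) * g ^ 2 * a * s ^ 4 := by
    rw [Matrix.det_succ_row_zero]
    simp [Z, Fin.sum_univ_succ, Matrix.det_fin_three, Matrix.submatrix_apply, Fin.succAbove]
    ring
  have hdu : IsUnit Z.det := by
    rw [hdet, isUnit_iff_ne_zero]
    simp [ha', hg', hs]
  refine ⟨Z, (Matrix.isUnit_iff_isUnit_det Z).2 hdu, ?_⟩
  have key : ((!![0, 0, 1, 0; 0, 0, 0, 1; -a, 0, 0, g; 0, -b, -h, 0] :
      Matrix (Fin 4) (Fin 4) ℝ).map (algebraMap ℝ ℂ)) * Z =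
      Z * !![s, 1, 0, 0; 0, s, 0, 0; 0, 0, -s, 1; 0, 0, 0, -s] := by
    ext i j
    fin_cases i <;> fin_cases j <;>
      simp [Z, Matrix.mul_apply, Fin.sum_univ_succ] <;>
      first
      | ring1
      | linear_combination -h0
      | linear_combination -h1
      | linear_combination h0
      | linear_combination h1
  rw [Matrix.mul_assoc, key, ← Matrix.mul_assoc, Matrix.nonsing_inv_mul _ hdu, Matrix.one_mul]

/-- If s₀ is a complex eigenvalue of the companion matrix 𝒞 of
algebraic multiplicity at least 2, then over ℂ the matrix 𝒞 is similar to the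
Jordan matrix 𝒥 made of two Jordan blocks of size 2 with eigenvalues s₀, −s₀. -/
theorem degenerate_eigenvalue_jordan_form
    (L₁ C₁ L₂ C₂ G₁ : ℝ) (hL₁ : L₁ ≠ 0) (hC₁ : C₁ ≠ 0) (hL₂ : L₂ ≠ 0)
    (hC₂ : C₂ ≠ 0) (hG₁ : G₁ ≠ 0) (s₀ : ℂ)
    (hroot :
      (((!![0, 0, 1, 0;
            0, 0, 0, 1;
            -(1/(L₁*C₁)), 0, 0, G₁/L₁;
            0, -(1/(L₂*C₂)), -(G₁/L₂), 0] : Matrix (Fin 4) (Fin 4) ℝ).charpoly).map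
          (algebraMap ℝ ℂ)).IsRoot s₀)
    (hmult :
      2 ≤ Polynomial.rootMultiplicity s₀
        (((!![0, 0, 1, 0;
              0, 0, 0, 1;
              -(1/(L₁*C₁)), 0, 0, G₁/L₁;
              0, -(1/(L₂*C₂)), -(G₁/L₂), 0] : Matrix (Fin 4) (Fin 4) ℝ).charpoly).map
            (algebraMap ℝ ℂ))) :
    ∃ Z : Matrix (Fin 4) (Fin 4) ℂ, IsUnit Z ∧
      Z⁻¹ *
        ((!![0, 0, 1, 0;
             0, 0, 0, 1;
             -(1/(L₁*C₁)), 0, 0, G₁/L₁;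
             0, -(1/(L₂*C₂)), -(G₁/L₂), 0] : Matrix (Fin 4) (Fin 4) ℝ).map
          (algebraMap ℝ ℂ)) * Z =
      !![s₀, 1, 0, 0;
         0, s₀, 0, 0;
         0, 0, -s₀, 1;
         0, 0, 0, -s₀] := by
  exact aux_main _ _ _ _ (one_div_ne_zero (mul_ne_zero hL₁ hC₁))
    (one_div_ne_zero (mul_ne_zero hL₂ hC₂)) (div_ne_zero hG₁ hL₁) s₀ hmult
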